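/- arXiv:0906.4668 — 2 statements merged into one kernel-verified Lean document; each statement's English description precedes it below -/
import Mathlib

section
/- Correctness of local password recovery: Let q be a prime, let n ≥ t ≥ 1, let D be an alphabet, and let p, p' : Fin n → D be the registered password and the guess, with p ≈_t p'. Let h, 𝔤 : Fin n → D → Z_q be the hash functions used at registration, and assume the map i ↦ h_i(p_i) is injective on Fin n. Let P be a polynomial over Z_q with deg P ≤ t−1, let s_i = P(h_i(p_i)), and let the stored recovery values be s_i − 𝔤_i(p_i). In the recovery phase the client forms the pairs (u_i, w_i) with u_i = h_i(p'_i) and w_i = (s_i − 𝔤_i(p_i)) + 𝔤_i(p'_i). Then there exists a subset T ⊆ Fin n with |T| = t such that: (1) for all i ∈ T, u_i = h_i(p_i) and w_i = P(u_i); (2) the map i ↦ u_i is injective on T; and (3) Σ_{i∈T} w_i · λ^T_{0,i} = P(0), where the Lagrange coefficients λ^T_{0,i} are computed with respect to the nodes u_i, i ∈ T. In particular, interpolating any t correct recovered points at 0 yields the shared secret P(0). -/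
open Polynomial Finset

/-- Lagrange coefficient `λ^T_{x₀,i}` with respect to nodes `u i`, `i ∈ T`,
and target point `x₀`. -/
noncomputable def lagrangeCoeff {q : ℕ} [Fact (Nat.Prime q)] {ι : Type*} [DecidableEq ι]
    (T : Finset ι) (u : ι → ZMod q) (x₀ : ZMod q) (i : ι) : ZMod q :=
  ∏ i' ∈ T.erase i, (x₀ - u i') / (u i - u i')

theorem lagrangeCoeff_eq_eval_basis {q : ℕ} [Fact (Nat.Prime q)] {ι : Type*} [DecidableEq ι]
    (T : Finset ι) (u : ι → ZMod q) (x₀ : ZMod q) (i : ι) :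
    lagrangeCoeff T u x₀ i = (Lagrange.basis T u i).eval x₀ := by
  simp only [lagrangeCoeff, Lagrange.basis, Lagrange.basisDivisor, eval_prod, eval_mul, eval_C,
    eval_sub, eval_X, div_eq_inv_mul]

/-- Lagrange interpolation of a polynomial of degree less than `#T`, at any target point. -/
theorem sum_mul_lagrangeCoeff {q : ℕ} [Fact (Nat.Prime q)] {ι : Type*} [DecidableEq ι]
    {T : Finset ι} {u w : ι → ZMod q} (hu : Set.InjOn u T) {P : Polynomial (ZMod q)}
    (hP : P.degree < #T) (hw : ∀ i ∈ T, P.eval (u i) = w i) (x₀ : ZMod q) :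
    ∑ i ∈ T, w i * lagrangeCoeff T u x₀ i = P.eval x₀ := by
  rw [Lagrange.eq_interpolate_of_eval_eq w hu hP hw, Lagrange.interpolate_apply, eval_finsetSum]
  simp only [lagrangeCoeff_eq_eval_basis, eval_mul, eval_C]

/-- Correctness of local password recovery: if the guess `p'` matches the
registered password `p` in at least `t` positions, then among the recovered pairs
`(u_i, w_i)` there are `t` correct points of the registration polynomial `P`,
with pairwise distinct nodes, whose interpolation at `0` yields the secret `P(0)`. -/
theorem local_password_recovery_correct
    {q : ℕ} [Fact (Nat.Prime q)] {D : Type*} [DecidableEq D]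
    {n t : ℕ} (ht : 1 ≤ t) (htn : t ≤ n)
    (p p' : Fin n → D)
    (hsim : t ≤ (Finset.univ.filter (fun i => p i = p' i)).card)
    (h 𝔤 : Fin n → D → ZMod q)
    (hinj : Function.Injective (fun i => h i (p i)))
    (P : Polynomial (ZMod q)) (hP : P.natDegree ≤ t - 1)
    (s : Fin n → ZMod q) (hs : ∀ i, s i = P.eval (h i (p i)))
    (u w : Fin n → ZMod q)
    (hu : ∀ i, u i = h i (p' i))
    (hw : ∀ i, w i = (s i - 𝔤 i (p i)) + 𝔤 i (p' i)) :
    ∃ T : Finset (Fin n), T.card = t ∧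
      (∀ i ∈ T, u i = h i (p i) ∧ w i = P.eval (u i)) ∧
      Set.InjOn u T ∧
      ∑ i ∈ T, w i * lagrangeCoeff T u 0 i = P.eval 0 := by
  obtain ⟨T, hT, hcard⟩ := Finset.exists_subset_card_eq hsim
  have hpp : ∀ i ∈ T, p i = p' i := fun i hi => (Finset.mem_filter.mp (hT hi)).2
  have hnode : ∀ i ∈ T, u i = h i (p i) := fun i hi => by rw [hu, hpp i hi]
  have hval : ∀ i ∈ T, w i = P.eval (u i) := fun i hi => by
    rw [hw, hnode i hi, ← hs, ← hpp i hi, sub_add_cancel]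
  have hinjOn : Set.InjOn u T := hinj.injOn.congr fun i hi => (hnode i hi).symm
  have hdeg : P.degree < #T := by
    refine lt_of_le_of_lt degree_le_natDegree ?_
    rw [hcard]
    exact_mod_cast (by omega : P.natDegree < t)
  exact ⟨T, hcard, fun i hi => ⟨hnode i hi, hval i hi⟩, hinjOn,
    sum_mul_lagrangeCoeff hinjOn hdeg (fun i hi => (hval i hi).symm) 0⟩
end

section
/- Correctness of the improved client–server password recovery (hash-based setting): Let q be a prime, G a commutative group, and g ∈ G an element of order q. Let n ≥ t ≥ 1, let D be an alphabet, and let p, p' : Fin n → D with p ≈_t p'. Let 𝔥, 𝔤 : Fin n → D → Z_q, and assume the map i ↦ 𝔥_i(p_i) is injective on Fin n. Let f be a polynomial over Z_q with deg f ≤ t−1, α = f(0), h = g^α, and set x_i = 𝔥_i(p_i), α_i = f(x_i), and stored values y_i = α_i − 𝔤_i(p_i). Let m ∈ G encode the password, let r ∈ Z_q, let (a, b) = (g^r, m·h^r) be the stored ciphertext, and let the server's potential partial decryptions be c_i = a^(y_i + 𝔤_i(p'_i)) for i ∈ Fin n. Then there exists a subset T ⊆ Fin n with |T| = t such that the map i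 ↦ 𝔥_i(p'_i) is injective on T and b · ( ∏_{i∈T} c_i^( λ^T_{0,i} ) )⁻¹ = m, where the Lagrange coefficients λ^T_{0,i} are computed with respect to the nodes 𝔥_i(p'_i), i ∈ T. In particular, a client whose guess matches the password in at least t positions recovers the plaintext m. -/
open Polynomial Finset

theorem eval_lagrangeBasis_eq_lagrangeCoeff {q : ℕ} [Fact (Nat.Prime q)] {ι : Type*}
    [DecidableEq ι] (T : Finset ι) (u : ι → ZMod q) (x₀ : ZMod q) (i : ι) :
    (Lagrange.basis T u i).eval x₀ = lagrangeCoeff T u x₀ i := by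
  simp only [Lagrange.basis, Lagrange.basisDivisor, lagrangeCoeff, eval_prod, eval_mul, eval_C,
    eval_sub, eval_X]
  exact Finset.prod_congr rfl fun j _ => by rw [div_eq_mul_inv, mul_comm]

theorem eval_eq_sum_eval_mul_lagrangeCoeff {q : ℕ} [Fact (Nat.Prime q)] {ι : Type*}
    [DecidableEq ι] {T : Finset ι} {u : ι → ZMod q} (hu : Set.InjOn u T)
    {f : (ZMod q)[X]} (hf : f.degree < T.card) (x₀ : ZMod q) :
    f.eval x₀ = ∑ i ∈ T, f.eval (u i) * lagrangeCoeff T u x₀ i := by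
  conv_lhs => rw [Lagrange.eq_interpolate hu hf]
  simp [Lagrange.interpolate_apply, eval_finsetSum, eval_lagrangeBasis_eq_lagrangeCoeff]

theorem pow_eq_pow_of_natCast_zmod_orderOf_eq {M : Type*} [LeftCancelMonoid M] {g : M}
    {q k l : ℕ} (hg : orderOf g = q) (hkl : (k : ZMod q) = l) : g ^ k = g ^ l := by
  rw [pow_eq_pow_iff_modEq, hg]
  exact (ZMod.natCast_eq_natCast_iff k l q).1 hkl

/-- Correctness of the improved client–server password recovery (hash-based
setting): a client whose guess `p'` matches the registered password `p` in at
least `t` positions can combine `t` of the server's potential partial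
decryptions to recover the plaintext `m`. -/
theorem improved_password_recovery_correct
    {q : ℕ} [Fact (Nat.Prime q)] {G : Type*} [CommGroup G] (g : G)
    (hg : orderOf g = q) {D : Type*} [DecidableEq D]
    {n t : ℕ} (ht : 1 ≤ t) (htn : t ≤ n)
    (p p' : Fin n → D)
    (hsim : t ≤ (Finset.univ.filter (fun i => p i = p' i)).card)
    (𝔥 𝔤 : Fin n → D → ZMod q)
    (hinj : Function.Injective (fun i => 𝔥 i (p i)))
    (f : Polynomial (ZMod q)) (hf : f.natDegree ≤ t - 1)
    (α : ZMod q) (hα : α = f.eval 0) (h : G) (hh : h = g ^ α.val)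
    (x αs y : Fin n → ZMod q)
    (hx : ∀ i, x i = 𝔥 i (p i))
    (hαs : ∀ i, αs i = f.eval (x i))
    (hy : ∀ i, y i = αs i - 𝔤 i (p i))
    (m : G) (r : ZMod q) (a b : G) (ha : a = g ^ r.val) (hb : b = m * h ^ r.val)
    (c : Fin n → G) (hc : ∀ i, c i = a ^ (y i + 𝔤 i (p' i)).val) :
    ∃ T : Finset (Fin n), T.card = t ∧
      Set.InjOn (fun i => 𝔥 i (p' i)) T ∧
      b * (∏ i ∈ T, (c i) ^ (lagrangeCoeff T (fun i => 𝔥 i (p' i)) 0 i).val)⁻¹ = m := by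
  obtain ⟨T, hTsub, hTcard⟩ := Finset.exists_subset_card_eq hsim
  have hp : ∀ i ∈ T, p' i = p i := fun i hi => ((Finset.mem_filter.1 (hTsub hi)).2).symm
  have hu : Set.InjOn (fun i => 𝔥 i (p' i)) T := by
    intro i hi j hj hij
    apply hinj
    simpa only [hp i hi, hp j hj] using hij
  refine ⟨T, hTcard, hu, ?_⟩
  have hdeg : f.degree < T.card := by
    refine lt_of_le_of_lt degree_le_natDegree ?_
    exact_mod_cast (by omega : f.natDegree < T.card)
  have hα_sum : α = ∑ i ∈ T,
      (y i + 𝔤 i (p' i)) * lagrangeCoeff T (fun i => 𝔥 i (p' i)) 0 i := by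
    rw [hα, eval_eq_sum_eval_mul_lagrangeCoeff hu hdeg 0]
    refine Finset.sum_congr rfl fun i hi => ?_
    rw [hy, hαs, hx, hp i hi, sub_add_cancel]
  have hmask : h ^ r.val = ∏ i ∈ T,
      (c i) ^ (lagrangeCoeff T (fun i => 𝔥 i (p' i)) 0 i).val := by
    simp only [hh, hc, ha, ← pow_mul, Finset.prod_pow_eq_pow_sum]
    apply pow_eq_pow_of_natCast_zmod_orderOf_eq hg
    push_cast
    simp only [ZMod.natCast_zmod_val]
    rw [hα_sum, Finset.sum_mul]
    exact Finset.sum_congr rfl fun i _ => by ring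
  rw [hb, hmask, mul_inv_cancel_right]
end
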